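/- arXiv:1809.00047 — 5 statements merged into one kernel-verified Lean document; each statement's English description precedes it below -/
import Mathlib

section
/- For every integer n ≥ 3 and every real number x with x ≥ δ*, one has P_n(x) > 0. Consequently, every real root of P_n is strictly less than δ*. -/
/-- For an integer `n ≥ 3`, `P n` is the real polynomial function
`P_n(x) = x^(n-2) * (x^3 - x - 1) + x^3 + x^2 - 1`. -/
noncomputable def P (n : ℕ) (x : ℝ) : ℝ :=
  x ^ (n - 2) * (x ^ 3 - x - 1) + x ^ 3 + x ^ 2 - 1

/-- A real root of `x^3 - x - 1` is greater than `1`. -/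
lemma one_lt_of_cube_sub_self_sub_one_eq_zero {d : ℝ} (hd : d ^ 3 - d - 1 = 0) : 1 < d := by
  by_contra! h
  rcases le_total 0 d with h0 | h0
  · nlinarith [mul_nonneg (mul_nonneg h0 (sub_nonneg.2 h)) (by linarith : 0 ≤ d + 1)]
  · rcases lt_or_ge (-1) d with h1 | h1
    · linarith [Odd.pow_nonpos (n := 3) (by decide) h0]
    · nlinarith [mul_nonneg (mul_nonneg (neg_nonneg.2 h0) (sub_nonneg.2 h))
        (by linarith : 0 ≤ -1 - d)]

/-- The polynomial `x^3 - x - 1` is nonnegative to the right of its real root. -/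
lemma cube_sub_self_sub_one_nonneg {d x : ℝ} (hd : d ^ 3 - d - 1 = 0) (hx : d ≤ x) :
    0 ≤ x ^ 3 - x - 1 := by
  have h1 := one_lt_of_cube_sub_self_sub_one_eq_zero hd
  have h2 : 0 ≤ x ^ 2 + x * d + d ^ 2 - 1 := by nlinarith
  linarith [mul_nonneg (sub_nonneg.2 hx) h2]

/-- For every integer `n ≥ 3` and every real `x ≥ δ*` (where `δ*` is the
unique real root of `x^3 - x - 1`), one has `P_n(x) > 0`. Consequently, every real root
of `P_n` is strictly less than `δ*`. -/
theorem Pn_pos_above_plastic (δstar : ℝ) (hδstar : δstar ^ 3 - δstar - 1 = 0)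
    (n : ℕ) (hn : 3 ≤ n) :
    (∀ x : ℝ, δstar ≤ x → 0 < P n x) ∧
      ∀ x : ℝ, P n x = 0 → x < δstar := by
  have hpos : ∀ x : ℝ, δstar ≤ x → 0 < P n x := by
    intro x hx
    have hx1 : 1 < x := (one_lt_of_cube_sub_self_sub_one_eq_zero hδstar).trans_le hx
    have h1 : 0 ≤ x ^ (n - 2) * (x ^ 3 - x - 1) :=
      mul_nonneg (by positivity) (cube_sub_self_sub_one_nonneg hδstar hx)
    have h2 : 1 < x ^ 2 := one_lt_pow₀ hx1 two_ne_zero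
    have h3 : 0 < x ^ 3 := by positivity
    unfold P
    linarith
  refine ⟨hpos, fun x hx => ?_⟩
  by_contra! h
  exact (hpos x h).ne' hx
end

section
/- For every integer n ≥ 10, there exists a real number x with 1 < x < δ* and P_n(x) < 0. -/
/-- For every integer `n ≥ 10`, there exists a real number `x` with
`1 < x < δ*` and `P_n(x) < 0`, where `δ*` is the unique real root of `x^3 - x - 1`. -/
theorem Pn_negative_somewhere (δstar : ℝ) (hδstar : δstar ^ 3 - δstar - 1 = 0)
    (n : ℕ) (hn : 10 ≤ n) :
    ∃ x : ℝ, 1 < x ∧ x < δstar ∧ P n x < 0 := by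
  refine ⟨11 / 10, by norm_num, ?_, ?_⟩
  · by_contra! h
    nlinarith [mul_nonneg (sub_nonneg.2 h) (sq_nonneg (δstar + 577 / 1000)),
      sq_nonneg (δstar + 6 / 10)]
  · have hpow : (11 / 10 : ℝ) ^ 8 ≤ (11 / 10) ^ (n - 2) :=
      pow_le_pow_right₀ (by norm_num) (by omega)
    unfold P
    linarith
end

section
/- For every integer n ≥ 10, the polynomial P_n has a real root δ with 1 < δ < δ*. -/
theorem lt_of_cube_sub_self_sub_one_eq_zero {x : ℝ} (hx : x ^ 3 - x - 1 = 0) :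
    11 / 10 < x := by
  by_contra! h
  rcases le_or_gt 0 x with h0 | h0
  · nlinarith [mul_nonneg h0 (sub_nonneg.2 h), mul_nonneg h0 (mul_nonneg h0 (sub_nonneg.2 h))]
  · have h1 : -1 < x := by
      by_contra! h1
      nlinarith [mul_nonneg (neg_nonneg.2 h0.le) (mul_nonneg (neg_nonneg.2 h0.le)
        (by linarith : 0 ≤ -1 - x)), mul_nonneg (neg_nonneg.2 h0.le) (by linarith : 0 ≤ -1 - x)]
    nlinarith [mul_pos (neg_pos.2 h0) (mul_pos (neg_pos.2 h0) (neg_pos.2 h0))]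

theorem P_eleven_tenths_neg {n : ℕ} (hn : 10 ≤ n) : P n (11 / 10) < 0 := by
  have h : (11 / 10 : ℝ) ^ 8 ≤ (11 / 10) ^ (n - 2) :=
    pow_le_pow_right₀ (by norm_num) (by lia)
  norm_num [P] at h ⊢
  linarith

theorem continuous_P (n : ℕ) : Continuous (P n) := by
  unfold P
  fun_prop

/-- For every integer `n ≥ 10`, the polynomial `P_n` has a real root `δ`
with `1 < δ < δ*`, where `δ*` is the unique real root of `x^3 - x - 1`. -/
theorem Pn_has_root_between (δstar : ℝ) (hδstar : δstar ^ 3 - δstar - 1 = 0)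
    (n : ℕ) (hn : 10 ≤ n) :
    ∃ δ : ℝ, 1 < δ ∧ δ < δstar ∧ P n δ = 0 := by
  have hlt := lt_of_cube_sub_self_sub_one_eq_zero hδstar
  have hpos : 0 < P n δstar := by
    simp only [P, hδstar]
    nlinarith [sq_nonneg δstar]
  obtain ⟨δ, ⟨h₁, h₂⟩, h₀⟩ := intermediate_value_Ioo hlt.le (continuous_P n).continuousOn
    ⟨P_eleven_tenths_neg hn, hpos⟩
  exact ⟨δ, by linarith, h₂, h₀⟩
end

section
/- For every integer n ≥ 10, the set of real roots of P_n is finite and nonempty, so it has a largest element δ_n; moreover this largest real root satisfies 1 < δ_n < δ*. -/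
theorem eleven_tenths_lt_of_plastic {d : ℝ} (hd : d ^ 3 - d - 1 = 0) : 11 / 10 < d := by
  by_contra! h
  rcases le_or_gt 0 d with h0 | h0
  · nlinarith [mul_nonneg h0 (sub_nonneg.2 h), mul_nonneg (mul_nonneg h0 h0) (sub_nonneg.2 h)]
  · rcases le_or_gt (-1) d with h1 | h1
    · nlinarith [pow_pos (neg_pos.2 h0) 3]
    · nlinarith [mul_pos (sub_pos.2 h1) (neg_pos.2 h0),
        mul_pos (mul_pos (sub_pos.2 h1) (neg_pos.2 h0)) (neg_pos.2 h0)]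

theorem P_pos_of_plastic_le {d x : ℝ} (hd : d ^ 3 - d - 1 = 0) (h : d ≤ x) (n : ℕ) :
    0 < P n x := by
  have hd1 := eleven_tenths_lt_of_plastic hd
  have hx : 1 < x := by linarith
  have hcubic : 0 ≤ x ^ 3 - x - 1 := by
    have hq : 0 ≤ x ^ 2 + x * d + d ^ 2 - 1 := by nlinarith
    nlinarith [mul_nonneg (sub_nonneg.2 h) hq]
  have hmul : 0 ≤ x ^ (n - 2) * (x ^ 3 - x - 1) := by positivity
  have h2 : 1 < x ^ 2 := one_lt_pow₀ hx two_ne_zero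
  have h3 : 0 < x ^ 3 := by positivity
  unfold P
  linarith

open Polynomial in
theorem finite_setOf_P_eq_zero {n : ℕ} (hn : 3 ≤ n) : {x : ℝ | P n x = 0}.Finite := by
  let p : ℝ[X] := X ^ (n - 2) * (X ^ 3 - X - 1) + X ^ 3 + X ^ 2 - 1
  have heval (x : ℝ) : p.eval x = P n x := by simp [p, P]
  have hp : p ≠ 0 := by
    intro h
    have h0 := heval 0
    have hn2 : n - 2 ≠ 0 := by omega
    simp [h, P, hn2] at h0
  refine (finite_setOfPred_isRoot hp).subset fun x hx => ?_
  exact (heval x).trans hx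

/-- For every integer `n ≥ 10`, the set of real roots of `P_n` is finite
and nonempty, so it has a largest element `δ_n`; moreover this largest real root
satisfies `1 < δ_n < δ*`, where `δ*` is the unique real root of `x^3 - x - 1`. -/
theorem Pn_largest_root_bounds (δstar : ℝ) (hδstar : δstar ^ 3 - δstar - 1 = 0)
    (n : ℕ) (hn : 10 ≤ n) :
    {x : ℝ | P n x = 0}.Finite ∧ {x : ℝ | P n x = 0}.Nonempty ∧
      ∃ δ : ℝ, IsGreatest {x : ℝ | P n x = 0} δ ∧ 1 < δ ∧ δ < δstar := by
  have hfin := finite_setOf_P_eq_zero (show 3 ≤ n by omega)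
  obtain ⟨r, hr, hr0⟩ := intermediate_value_Icc (eleven_tenths_lt_of_plastic hδstar).le
    (continuous_P n).continuousOn
    ⟨(P_eleven_tenths_neg hn).le, (P_pos_of_plastic_le hδstar le_rfl n).le⟩
  obtain ⟨δ, hδ, hmax⟩ := Set.exists_max_image _ id hfin ⟨r, hr0⟩
  refine ⟨hfin, ⟨r, hr0⟩, δ, ⟨hδ, hmax⟩, ?_, ?_⟩
  · have hle : r ≤ δ := hmax r hr0
    linarith [hr.1]
  · by_contra! h
    exact (P_pos_of_plastic_le hδstar h n).ne' hδ
end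

section
/- The sequence (δ_n)_{n ≥ 10} of largest real roots converges to δ* as n → ∞, increasing monotonically. -/
theorem one_point_two_lt_of_plastic {s : ℝ} (hs : s ^ 3 - s - 1 = 0) : 1.2 < s := by
  by_contra! h
  nlinarith [mul_nonneg (sub_nonneg.2 h) (sq_nonneg (s + 0.6))]

theorem cubic_neg_iff_lt_plastic {s x : ℝ} (hs : s ^ 3 - s - 1 = 0) (hx : 1 ≤ x) :
    x ^ 3 - x - 1 < 0 ↔ x < s := by
  have h1 := one_point_two_lt_of_plastic hs
  have key : x ^ 3 - x - 1 = (x - s) * (x ^ 2 + x * s + s ^ 2 - 1) := by linear_combination hs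
  have hpos : 0 < x ^ 2 + x * s + s ^ 2 - 1 := by nlinarith
  rw [key, ← not_le, mul_nonneg_iff_of_pos_right hpos, sub_nonneg, not_le]

theorem cofactor_pos {x : ℝ} (hx : 1 ≤ x) : 0 < x ^ 3 + x ^ 2 - 1 := by
  have h2 := one_le_pow₀ hx (n := 2)
  have h3 := one_le_pow₀ hx (n := 3)
  linarith

theorem P_eq (n : ℕ) (x : ℝ) :
    P n x = x ^ (n - 2) * (x ^ 3 - x - 1) + (x ^ 3 + x ^ 2 - 1) := by
  unfold P; ring

theorem lt_of_P_neg {n : ℕ} {s a d : ℝ} (hs : s ^ 3 - s - 1 = 0)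
    (hd : IsGreatest {x : ℝ | P n x = 0} d) (ha : 1 ≤ a) (has : a ≤ s) (hP : P n a < 0) :
    a < d := by
  have hPs : 0 < P n s := by
    rw [P_eq, hs, mul_zero, zero_add]
    exact cofactor_pos (ha.trans has)
  have hcont : ContinuousOn (P n) (Set.Icc a s) := by
    unfold P; fun_prop
  obtain ⟨x, hx, hx0⟩ := intermediate_value_Ioo has hcont ⟨hP, hPs⟩
  exact hx.1.trans_le (hd.2 hx0)

theorem P_one_point_one_neg {n : ℕ} (hn : 10 ≤ n) : P n 1.1 < 0 := by
  have h : (1.1 : ℝ) ^ 8 ≤ 1.1 ^ (n - 2) := pow_le_pow_right₀ (by norm_num) (by omega)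
  rw [P_eq]
  norm_num at h ⊢
  linarith

theorem lt_plastic_of_P_eq_zero {n : ℕ} {s d : ℝ} (hs : s ^ 3 - s - 1 = 0) (hd : 1 ≤ d)
    (hP : P n d = 0) : d < s := by
  rw [← cubic_neg_iff_lt_plastic hs hd]
  by_contra! h
  have := mul_nonneg (pow_nonneg (zero_le_one.trans hd) (n - 2)) h
  have := cofactor_pos hd
  rw [P_eq] at hP
  linarith

theorem P_succ_neg_of_P_eq_zero {n : ℕ} {d : ℝ} (hn : 2 ≤ n) (hd : 1 < d) (hP : P n d = 0) :
    P (n + 1) d < 0 := by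
  have hsub : n + 1 - 2 = n - 2 + 1 := by omega
  have h : P (n + 1) d = (1 - d) * (d ^ 3 + d ^ 2 - 1) := by
    rw [P_eq] at hP ⊢
    rw [hsub, pow_succ]
    linear_combination d * hP
  rw [h]
  exact mul_neg_of_neg_of_pos (by linarith) (cofactor_pos hd.le)

theorem eventually_P_neg {a : ℝ} (ha : 1 < a) (hf : a ^ 3 - a - 1 < 0) :
    ∀ᶠ n in Filter.atTop, P n a < 0 := by
  have h : Filter.Tendsto (fun n : ℕ => a ^ (n - 2)) Filter.atTop Filter.atTop :=
    (tendsto_pow_atTop_atTop_of_one_lt ha).comp (Filter.tendsto_sub_atTop_nat 2)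
  have h' : Filter.Tendsto (P · a) Filter.atTop Filter.atBot := by
    simp only [P_eq]
    exact Filter.tendsto_atBot_add_const_right _ _ (h.atTop_mul_const_of_neg hf)
  exact h'.eventually_lt_atBot 0

/-- The sequence `(δ_n)_{n ≥ 10}` of largest real roots of the `P_n`
converges to `δ*` (the unique real root of `x^3 - x - 1`) as `n → ∞`, increasing
monotonically. -/
theorem largest_roots_tendsto_plastic (δstar : ℝ) (hδstar : δstar ^ 3 - δstar - 1 = 0)
    (δ : ℕ → ℝ) (hδ : ∀ n : ℕ, 10 ≤ n → IsGreatest {x : ℝ | P n x = 0} (δ n)) :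
    (∀ n : ℕ, 10 ≤ n → δ n < δ (n + 1)) ∧
      Filter.Tendsto δ Filter.atTop (nhds δstar) := by
  have hs := one_point_two_lt_of_plastic hδstar
  have hlow (n : ℕ) (hn : 10 ≤ n) : 1.1 < δ n :=
    lt_of_P_neg hδstar (hδ n hn) (by norm_num) (by linarith) (P_one_point_one_neg hn)
  have hone (n : ℕ) (hn : 10 ≤ n) : 1 < δ n := lt_trans (by norm_num) (hlow n hn)
  have hup (n : ℕ) (hn : 10 ≤ n) : δ n < δstar :=
    lt_plastic_of_P_eq_zero hδstar (hone n hn).le (hδ n hn).1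
  refine ⟨fun n hn => ?_, tendsto_order.2 ⟨fun a ha => ?_, fun a ha => ?_⟩⟩
  · exact lt_of_P_neg hδstar (hδ (n + 1) (by omega)) (hone n hn).le (hup n hn).le
      (P_succ_neg_of_P_eq_zero (by omega) (hone n hn) (hδ n hn).1)
  · have hb : 1 < max a 1.1 := lt_max_of_lt_right (by norm_num)
    have hbs : max a 1.1 < δstar := max_lt ha (by linarith)
    filter_upwards [eventually_P_neg hb ((cubic_neg_iff_lt_plastic hδstar hb.le).2 hbs),
      Filter.eventually_ge_atTop 10] with n hP hn
    exact (le_max_left _ _).trans_lt (lt_of_P_neg hδstar (hδ n hn) hb.le hbs.le hP)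
  · filter_upwards [Filter.eventually_ge_atTop 10] with n hn
    exact (hup n hn).trans ha
end
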